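/- arXiv:2404.11430 — 4 statements merged into one kernel-verified Lean document; each statement's English description precedes it below -/
import Mathlib

section
/- If a metric space (M,d) has the FSLTP, then M has the SLTP. -/
/-- A finitely additive nonnegative measure on a set `E`. -/
def IsFinAddMeasure {E : Type*} (μ : Set E → ℝ) : Prop :=
  μ ∅ = 0 ∧ (∀ S : Set E, 0 ≤ μ S) ∧
    ∀ S T : Set E, Disjoint S T → μ (S ∪ T) = μ S + μ T

/-- `M̃ = {(x,y) ∈ M × M : x ≠ y}`. -/
def Mtilde (M : Type*) : Type _ := {p : M × M // p.1 ≠ p.2}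

/-- `Γ_A = {(x,y) ∈ M̃ : x ∈ A or y ∈ A}`. -/
def Gamma {M : Type*} (A : Set M) : Set (Mtilde M) :=
  {p : Mtilde M | p.val.1 ∈ A ∨ p.val.2 ∈ A}

/-- The metric space `M` has the FSLTP. -/
def FSLTP (M : Type*) [MetricSpace M] : Prop :=
  ∀ μ : Set (Mtilde M) → ℝ, IsFinAddMeasure μ →
    ∀ ε : ℝ, 0 < ε → ∀ (n : ℕ) (f : Fin n → M → ℝ),
      (∀ (i : Fin n) (x y : M), |f i x - f i y| ≤ dist x y) →
      ∃ (A : Set M) (u v : M), μ (Gamma A) < ε ∧ u ∈ A ∧ v ∈ A ∧ u ≠ v ∧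
        (∀ (i : Fin n), ∀ x ∉ A, ∀ y ∉ A,
          (1 - ε) * (f i x - f i y + dist u v) ≤ dist x u + dist y v) ∧
        (∀ (i j : Fin n), ∀ x ∉ A, ∀ y ∉ A, ∀ z ∉ A, ∀ w ∉ A,
          (1 - ε) * (f i x - f i y + f j z - f j w + 2 * dist u v) ≤
            dist x u + dist y u + dist z v + dist w v)

/-- The metric space `M` has the SLTP. -/
def SLTP (M : Type*) [MetricSpace M] : Prop :=
  ∀ N : Set M, N.Finite → ∀ ε : ℝ, 0 < ε →
    ∃ u v : M, u ≠ v ∧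
      (∀ x ∈ N, ∀ y ∈ N,
        (1 - ε) * (dist x y + dist u v) ≤ dist x u + dist y v) ∧
      (∀ x ∈ N, ∀ y ∈ N, ∀ z ∈ N, ∀ w ∈ N,
        (1 - ε) * (2 * dist u v + dist x y + dist z w) ≤
          dist x u + dist y u + dist z v + dist w v)

/-- Counting the members of a finite family that lie in a set is a finitely additive measure. -/
theorem isFinAddMeasure_sum_indicator {ι E : Type*} (s : Finset ι) (g : ι → E) :
    IsFinAddMeasure fun S : Set E => ∑ i ∈ s, S.indicator (fun _ => (1 : ℝ)) (g i) := by
  refine ⟨by simp, fun S => Finset.sum_nonneg fun i _ =>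
    Set.indicator_nonneg (fun _ _ => zero_le_one) _, fun S T hST => ?_⟩
  simp only [Set.indicator_union_of_disjoint hST, Finset.sum_add_distrib]

theorem FSLTP.nontrivial {M : Type*} [MetricSpace M] (h : FSLTP M) : Nontrivial M := by
  obtain ⟨-, u, v, -, -, -, huv, -⟩ := h (fun _ => 0) ⟨rfl, fun _ => le_rfl, by simp⟩ 1
    one_pos 0 (fun _ _ => 0) (by simp)
  exact ⟨u, v, huv⟩

theorem stmt_7 {M : Type*} [MetricSpace M] (h : FSLTP M) : SLTP M := by
  intro N hN ε hε
  have := h.nontrivial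
  choose c hc using fun x : M => exists_ne x
  let g : M → Mtilde M := fun x => ⟨(x, c x), (hc x).symm⟩
  let e := hN.toFinset.equivFin
  obtain ⟨A, u, v, hA, -, -, huv, h₁, h₂⟩ := h _ (isFinAddMeasure_sum_indicator hN.toFinset g)
    (min ε 1) (lt_min hε one_pos) _ (fun i x => dist x (e.symm i))
    (fun i x y => abs_dist_sub_le x y _)
  have hNA : ∀ x ∈ N, x ∉ A := by
    intro x hx hxA
    have hle := Finset.single_le_sum
      (f := fun i => (Gamma A).indicator (fun _ => (1 : ℝ)) (g i))
      (fun i _ => Set.indicator_nonneg (fun _ _ => zero_le_one) _) (hN.mem_toFinset.2 hx)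
    have hgx : g x ∈ Gamma A := Or.inl hxA
    simp only [Set.indicator_of_mem hgx] at hle
    exact absurd (hle.trans_lt hA) (not_lt.2 (min_le_right _ _))
  have hidx : ∀ y ∈ N, ∃ i, (e.symm i : M) = y := fun y hy =>
    ⟨e ⟨y, hN.mem_toFinset.2 hy⟩, by simp⟩
  have hmono : ∀ a : ℝ, 0 ≤ a → (1 - ε) * a ≤ (1 - min ε 1) * a := fun a ha =>
    mul_le_mul_of_nonneg_right (sub_le_sub_left (min_le_left _ _) _) ha
  refine ⟨u, v, huv, fun x hx y hy => ?_, fun x hx y hy z hz w hw => ?_⟩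
  · obtain ⟨i, hi⟩ := hidx y hy
    have hxy := h₁ i x (hNA x hx) y (hNA y hy)
    simp only [hi, dist_self, sub_zero] at hxy
    exact (hmono _ (by positivity)).trans hxy
  · obtain ⟨i, hi⟩ := hidx y hy
    obtain ⟨j, hj⟩ := hidx w hw
    have hxyzw := h₂ i j x (hNA x hx) y (hNA y hy) z (hNA z hz) w (hNA w hw)
    simp only [hi, hj, dist_self, sub_zero] at hxyzw
    refine (hmono _ (by positivity)).trans (le_trans (le_of_eq ?_) hxyzw)
    ring
end

section
/- The metric space M₁ has the FLTP. -/
/-- The distance on the metric space `M₁` with underlying set `ℕ × Fin 3`, writing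
`a_k = (k, 0)`, `b_k = (k, 1)`, `c_k = (k, 2)`:  `d1 p p = 0`; `d1 (a_k) (c_k) = 2`;
`d1 (a_k) (b_l) = d1 (b_k) (b_l) = d1 (c_k) (b_l) = 2` whenever `k < l`; and the distance
between two distinct points is `1` in all other cases (`d1` is symmetric). -/
def d1 (p q : ℕ × Fin 3) : ℝ :=
  if p = q then 0
  else if (p.2 = 0 ∧ q.2 = 2 ∧ p.1 = q.1) ∨ (p.2 = 2 ∧ q.2 = 0 ∧ p.1 = q.1)
      ∨ (q.2 = 1 ∧ p.1 < q.1) ∨ (p.2 = 1 ∧ q.1 < p.1) then 2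
  else 1

/-- `M̃₁ = {(x,y) ∈ M₁ × M₁ : x ≠ y}`. -/
def Mtilde1 : Type := {p : (ℕ × Fin 3) × (ℕ × Fin 3) // p.1 ≠ p.2}

/-- `Γ_A = {(x,y) ∈ M̃₁ : x ∈ A or y ∈ A}`. -/
def Gamma1 (A : Set (ℕ × Fin 3)) : Set Mtilde1 :=
  {p : Mtilde1 | p.val.1 ∈ A ∨ p.val.2 ∈ A}

lemma d1_nonneg (p q : ℕ × Fin 3) : 0 ≤ d1 p q := by
  unfold d1
  split_ifs <;> norm_num

lemma d1_le_two (p q : ℕ × Fin 3) : d1 p q ≤ 2 := by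
  unfold d1
  split_ifs <;> norm_num

lemma d1_eq_one_or_two {p q : ℕ × Fin 3} (h : p ≠ q) : d1 p q = 1 ∨ d1 p q = 2 := by
  unfold d1
  rw [if_neg h]
  split_ifs <;> simp

/-- If `x` and `y` lie outside level `k`, and both `d1 x a_k` and `d1 y b_k` equal `1`, then `x`
and `y` are at distance at most `1` unless `{x, y} = {a_m, c_m}` for some `m > k`. -/
lemma d1_le_one_or_antipodal {k : ℕ} {x y : ℕ × Fin 3} (hx : x.1 ≠ k) (hy : y.1 ≠ k)
    (hxa : d1 x (k, 0) = 1) (hyb : d1 y (k, 1) = 1) :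
    d1 x y ≤ 1 ∨ ∃ m, k < m ∧ (x = (m, 0) ∧ y = (m, 2) ∨ x = (m, 2) ∧ y = (m, 0)) := by
  obtain ⟨m, i⟩ := x
  obtain ⟨l, j⟩ := y
  simp only [d1, Prod.mk.injEq] at *
  fin_cases i <;> fin_cases j <;> simp at * <;> grind

lemma IsFinAddMeasure.mono {E : Type*} {μ : Set E → ℝ} (hμ : IsFinAddMeasure μ) {S T : Set E}
    (h : S ⊆ T) : μ S ≤ μ T := by
  have hadd := hμ.2.2 S (T \ S) Set.disjoint_sdiff_right
  rw [Set.union_sdiff_cancel h] at hadd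
  linarith [hμ.2.1 (T \ S)]

lemma IsFinAddMeasure.union_le {E : Type*} {μ : Set E → ℝ} (hμ : IsFinAddMeasure μ)
    (S T : Set E) : μ (S ∪ T) ≤ μ S + μ T := by
  have hadd := hμ.2.2 S (T \ S) Set.disjoint_sdiff_right
  rw [Set.union_sdiff_self] at hadd
  linarith [hμ.mono (Set.sdiff_subset : T \ S ⊆ T)]

lemma IsFinAddMeasure.sum_fiber {E ι : Type*} {μ : Set E → ℝ} (hμ : IsFinAddMeasure μ)
    (g : E → ι) (s : Finset ι) : ∑ k ∈ s, μ {e | g e = k} = μ {e | g e ∈ s} := by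
  classical
  induction s using Finset.induction_on with
  | empty => simp [hμ.1]
  | insert k s hk ih =>
    rw [Finset.sum_insert hk, ih, ← hμ.2.2]
    · congr 1
      ext e
      simp
    · rw [Set.disjoint_left]
      rintro e rfl
      exact hk

/-- Some level of `M₁` beyond `k₀` meets a set of pairs of small measure. -/
lemma exists_level_measure_lt {μ : Set Mtilde1 → ℝ} (hμ : IsFinAddMeasure μ) {ε : ℝ}
    (hε : 0 < ε) (k₀ : ℕ) : ∃ k ≥ k₀, μ (Gamma1 {p | p.1 = k}) < ε := by
  by_contra! h
  obtain ⟨N, hN⟩ := exists_nat_gt (2 * μ Set.univ / ε)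
  rw [div_lt_iff₀ hε] at hN
  have hfst := hμ.sum_fiber (fun p => p.val.1.1) (Finset.Ico k₀ (k₀ + N))
  have hsnd := hμ.sum_fiber (fun p => p.val.2.1) (Finset.Ico k₀ (k₀ + N))
  have hlow : ∑ _k ∈ Finset.Ico k₀ (k₀ + N), ε ≤ ∑ k ∈ Finset.Ico k₀ (k₀ + N),
      (μ {p | p.val.1.1 = k} + μ {p | p.val.2.1 = k}) :=
    Finset.sum_le_sum fun k hk =>
      (h k (Finset.mem_Ico.1 hk).1).trans (hμ.union_le {p | p.val.1.1 = k} {p | p.val.2.1 = k})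
  rw [Finset.sum_add_distrib, hfst, hsnd] at hlow
  simp only [Finset.sum_const, Nat.card_Ico, add_tsub_cancel_left, nsmul_eq_mul] at hlow
  linarith [hμ.mono (Set.subset_univ {p : Mtilde1 | p.val.1.1 ∈ Finset.Ico k₀ (k₀ + N)}),
    hμ.mono (Set.subset_univ {p : Mtilde1 | p.val.2.1 ∈ Finset.Ico k₀ (k₀ + N)})]

/-- A `1`-Lipschitz function separates `a_m` from `c_m` by more than `1 + ε` for only finitely
many `m`. -/
lemma finite_setOf_lt_abs_sub {g : ℕ × Fin 3 → ℝ} (hg : ∀ p q, |g p - g q| ≤ d1 p q) {ε : ℝ}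
    (hε : 0 < ε) : {m : ℕ | 1 + ε < |g (m, 0) - g (m, 2)|}.Finite := by
  by_contra hinf
  have hmaps : Set.MapsTo (fun m : ℕ => ⌊g (m, 0) / ε⌋)
      {m : ℕ | 1 + ε < |g (m, 0) - g (m, 2)|}
      (Set.Icc ⌊(g (0, 0) - 2) / ε⌋ ⌊(g (0, 0) + 2) / ε⌋) := by
    intro m _
    have hm := abs_le.1 ((hg (m, 0) (0, 0)).trans (d1_le_two _ _))
    constructor <;> refine Int.floor_le_floor ?_ <;> gcongr <;> linarith
  obtain ⟨m, hm, l, -, hml, heq⟩ :=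
    Set.Infinite.exists_ne_map_eq_of_mapsTo hinf hmaps (Set.finite_Icc _ _)
  have hclose := Int.abs_sub_lt_one_of_floor_eq_floor heq
  rw [← sub_div, abs_div, abs_of_pos hε, div_lt_one hε] at hclose
  have hcross : d1 (l, 0) (m, 2) = 1 := by
    simp [d1, hml.symm]
  have hsplit := abs_sub_le (g (m, 0)) (g (l, 0)) (g (m, 2))
  have hlip := hg (l, 0) (m, 2)
  simp only [Set.mem_ofPred_eq] at hm
  linarith

/-- The metric space `M₁` (that is, `ℕ × Fin 3` with the distance `d1`) has the FLTP. -/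
theorem stmt_10 (μ : Set Mtilde1 → ℝ) (hμ : IsFinAddMeasure μ)
    (ε : ℝ) (hε : 0 < ε) (n : ℕ) (f : Fin n → ℕ × Fin 3 → ℝ)
    (hf : ∀ (i : Fin n) (p q : ℕ × Fin 3), |f i p - f i q| ≤ d1 p q) :
    ∃ (A : Set (ℕ × Fin 3)) (u v : ℕ × Fin 3),
      μ (Gamma1 A) < ε ∧ u ∈ A ∧ v ∈ A ∧ u ≠ v ∧
        ∀ (i : Fin n), ∀ x ∉ A, ∀ y ∉ A,
          (1 - ε) * (f i x - f i y + d1 u v) ≤ d1 x u + d1 y v := by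
  have hfin : (⋃ i, {m : ℕ | 1 + ε < |f i (m, 0) - f i (m, 2)|}).Finite :=
    Set.finite_iUnion fun i => finite_setOf_lt_abs_sub (hf i) hε
  obtain ⟨k₀, hk₀⟩ := hfin.bddAbove
  obtain ⟨k, hk, hμk⟩ := exists_level_measure_lt hμ hε k₀
  have hsep : ∀ i, ∀ m > k, |f i (m, 0) - f i (m, 2)| ≤ 1 + ε := by
    intro i m hm
    by_contra! hlt
    have := hk₀ (Set.mem_iUnion.2 ⟨i, hlt⟩)
    omega
  rcases le_or_gt 1 ε with h1 | h1
  · refine ⟨{p | p.1 = k}, (k, 0), (k, 2), hμk, rfl, rfl, by simp, fun i x _ y _ => ?_⟩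
    have huv : d1 (k, 0) (k, 2) = 2 := by simp [d1]
    have hxy := abs_le.1 ((hf i x y).trans (d1_le_two x y))
    refine (mul_nonpos_of_nonpos_of_nonneg (by linarith) ?_).trans
      (add_nonneg (d1_nonneg _ _) (d1_nonneg _ _))
    linarith
  · refine ⟨{p | p.1 = k}, (k, 0), (k, 1), hμk, rfl, rfl, by simp, fun i x hx y hy => ?_⟩
    have huv : d1 (k, 0) (k, 1) = 1 := by simp [d1]
    have hxa := d1_eq_one_or_two (p := x) (q := (k, 0)) (by rintro rfl; exact hx rfl)
    have hyb := d1_eq_one_or_two (p := y) (q := (k, 1)) (by rintro rfl; exact hy rfl)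
    have hxy := abs_le.1 ((hf i x y).trans (d1_le_two x y))
    rw [huv]
    by_cases hclose : d1 x (k, 0) = 1 ∧ d1 y (k, 1) = 1
    · have hle : f i x - f i y ≤ 1 + ε := by
        rcases d1_le_one_or_antipodal hx hy hclose.1 hclose.2 with
          h | ⟨m, hm, ⟨rfl, rfl⟩ | ⟨rfl, rfl⟩⟩
        · linarith [le_abs_self (f i x - f i y), hf i x y]
        · exact (le_abs_self _).trans (hsep i m hm)
        · linarith [neg_abs_le (f i (m, 0) - f i (m, 2)), hsep i m hm]
      rw [hclose.1, hclose.2]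
      nlinarith
    · have hfar : 3 ≤ d1 x (k, 0) + d1 y (k, 1) := by
        rcases hxa with h | h <;> rcases hyb with h' | h' <;> rw [h, h'] <;> norm_num
        exact hclose ⟨h, h'⟩
      nlinarith
end

section
/- Let 0 < α < 1/13 and let f, f′ : M₂ → ℝ both satisfy: they are 1-Lipschitz with respect to d; they vanish at c₁; f(a₁) − f(a₂) > 2 − 4α and f′(a₁) − f′(a₂) > 2 − 4α; and f(b_{2n−1}) − f(b_{2n}) > 2 − 4α for infinitely many n, and likewise for f′. Then for all x, y ∈ M₂ with x ≠ y: |(f − f′)(x) − (f − f′)(y)| ≤ (1 + 20α)·d(x,y). In particular, the set of all such functions has diameter strictly less than 2 in the Lipschitz seminorm. -/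
/-- The underlying set of the metric space `M₂`: the points `a₁ = Sum.inl 0` and
`a₂ = Sum.inl 1`, together with `b_{m+1} = Sum.inr (m, 0)` and `c_{m+1} = Sum.inr (m, 1)`
for `m : ℕ` (so `Sum.inr (m, j)` represents the point with index `m + 1 ≥ 1` of the paper). -/
abbrev M2 : Type := Fin 2 ⊕ (ℕ × Fin 2)

/-- The point `a₁` of `M₂`. -/
def pa1 : M2 := Sum.inl 0
/-- The point `a₂` of `M₂`. -/
def pa2 : M2 := Sum.inl 1
/-- The point `b_{m+1}` of `M₂` (indices of the paper start from `1`). -/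
def pb (m : ℕ) : M2 := Sum.inr (m, 0)
/-- The point `c_{m+1}` of `M₂` (indices of the paper start from `1`). -/
def pc (m : ℕ) : M2 := Sum.inr (m, 1)

/-- Adjacency (distance-one) relation of `M₂`: `d(a₁, b_{2k-1}) = d(a₂, b_{2k}) = 1` and
`d(c_k, b_l) = 1` whenever `k ≤ l`.  In terms of the formal indices (shifted by one),
`a₁` is adjacent to `b`-points with even formal index, `a₂` to `b`-points with odd formal
index, and `c` with formal index `k` is adjacent to `b` with formal index `l` iff `k ≤ l`. -/
def Adj2 : M2 → M2 → Prop
  | Sum.inl i, Sum.inr q => q.2 = 0 ∧ ((i = 0 ∧ Even q.1) ∨ (i = 1 ∧ Odd q.1))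
  | Sum.inr q, Sum.inl i => q.2 = 0 ∧ ((i = 0 ∧ Even q.1) ∨ (i = 1 ∧ Odd q.1))
  | Sum.inr p, Sum.inr q =>
      (p.2 = 1 ∧ q.2 = 0 ∧ p.1 ≤ q.1) ∨ (p.2 = 0 ∧ q.2 = 1 ∧ q.1 ≤ p.1)
  | Sum.inl _, Sum.inl _ => False

open Classical in
/-- The distance of the metric space `M₂`: distinct adjacent points are at distance `1`,
all other pairs of distinct points are at distance `2`. -/
noncomputable def d2 (p q : M2) : ℝ :=
  if p = q then 0 else if Adj2 p q then 1 else 2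
lemma d2_le_two (p q : M2) : d2 p q ≤ 2 := by
  unfold d2
  split_ifs <;> norm_num

lemma one_le_d2 {p q : M2} (h : p ≠ q) : 1 ≤ d2 p q := by
  unfold d2
  rw [if_neg h]
  split_ifs <;> norm_num

lemma d2_le_one {p q : M2} (h : Adj2 p q) : d2 p q ≤ 1 := by
  unfold d2
  split_ifs <;> norm_num

lemma d2_pb_pb {m n : ℕ} (h : pb m ≠ pb n) : d2 (pb m) (pb n) = 2 := by
  unfold d2
  rw [if_neg h, if_neg (by simp [Adj2, pb])]

lemma M2_cases (x : M2) : x = pa1 ∨ x = pa2 ∨ (∃ m, x = pb m) ∨ ∃ m, x = pc m := by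
  rcases x with i | ⟨m, i⟩ <;> fin_cases i <;> simp [pa1, pa2, pb, pc]

/-- A `1`-Lipschitz function vanishing at `c₁` that nearly attains the slope `1` between `a₁` and
`a₂`, and between infinitely many pairs `b_{2n-1}`, `b_{2n}`, is almost determined at the points
`a₁`, `a₂`, `c_k`, and its values at the points `b_m` lie in one half of `[-1, 1]` up to `8α`. -/
lemma bounds_of_nearly_extremal {α : ℝ} {f : M2 → ℝ}
    (hLip : ∀ x y : M2, |f x - f y| ≤ d2 x y) (hc : f (pc 0) = 0)
    (ha : 2 - 4 * α < f pa1 - f pa2)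
    (hb : {n : ℕ | 2 - 4 * α < f (pb (2 * n)) - f (pb (2 * n + 1))}.Infinite) :
    (1 - 8 * α ≤ f pa1 ∧ f pa1 ≤ 1 + 4 * α) ∧ (-1 - 4 * α ≤ f pa2 ∧ f pa2 ≤ -1 + 8 * α) ∧
      (∀ k, |f (pc k)| ≤ 4 * α) ∧ (∀ m, Even m → -(8 * α) ≤ f (pb m) ∧ f (pb m) ≤ 1) ∧
      (∀ m, Odd m → -1 ≤ f (pb m) ∧ f (pb m) ≤ 8 * α) := by
  have hadj : ∀ {x y}, Adj2 x y → -1 ≤ f x - f y ∧ f x - f y ≤ 1 := fun {x y} h =>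
    abs_le.1 ((hLip x y).trans (d2_le_one h))
  have htwo : ∀ x y, -2 ≤ f x - f y ∧ f x - f y ≤ 2 := fun x y =>
    abs_le.1 ((hLip x y).trans (d2_le_two x y))
  have hcb : ∀ k l, k ≤ l → -1 ≤ f (pc k) - f (pb l) ∧ f (pc k) - f (pb l) ≤ 1 := fun k l h =>
    hadj (by simpa [Adj2, pc, pb] using h)
  have hfb : ∀ m, -1 ≤ f (pb m) ∧ f (pb m) ≤ 1 := fun m => by
    have := hcb 0 m m.zero_le
    constructor <;> linarith
  have hfc : ∀ k, |f (pc k)| ≤ 4 * α := fun k => by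
    obtain ⟨n, hn, hkn⟩ := hb.exists_gt k
    rw [Set.mem_ofPred_eq] at hn
    have h0 := hcb k (2 * n) (by omega)
    have h1 := hcb k (2 * n + 1) (by omega)
    have h2 := hfb (2 * n)
    have h3 := hfb (2 * n + 1)
    rw [abs_le]
    constructor <;> linarith
  obtain ⟨n, hn⟩ := hb.nonempty
  rw [Set.mem_ofPred_eq] at hn
  have h0 := hfb (2 * n)
  have h1 := hfb (2 * n + 1)
  have h2 := htwo pa1 (pb (2 * n + 1))
  have h3 := htwo pa2 (pb (2 * n))
  refine ⟨⟨by linarith, by linarith⟩, ⟨by linarith, by linarith⟩, hfc, fun m hm => ?_,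
    fun m hm => ?_⟩
  · have h4 : -1 ≤ f pa1 - f (pb m) ∧ f pa1 - f (pb m) ≤ 1 :=
      hadj (by simpa [Adj2, pa1, pb] using hm)
    exact ⟨by linarith, (hfb m).2⟩
  · have h4 : -1 ≤ f pa2 - f (pb m) ∧ f pa2 - f (pb m) ≤ 1 :=
      hadj (by simpa [Adj2, pa2, pb] using hm)
    exact ⟨(hfb m).1, by linarith⟩

theorem stmt_14 (α : ℝ) (hα0 : 0 < α) (hα1 : α < 1 / 13) (f f' : M2 → ℝ)
    (hLip : ∀ x y : M2, |f x - f y| ≤ d2 x y)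
    (hLip' : ∀ x y : M2, |f' x - f' y| ≤ d2 x y)
    (hc : f (pc 0) = 0) (hc' : f' (pc 0) = 0)
    (ha : 2 - 4 * α < f pa1 - f pa2) (ha' : 2 - 4 * α < f' pa1 - f' pa2)
    (hb : {n : ℕ | 2 - 4 * α < f (pb (2 * n)) - f (pb (2 * n + 1))}.Infinite)
    (hb' : {n : ℕ | 2 - 4 * α < f' (pb (2 * n)) - f' (pb (2 * n + 1))}.Infinite) :
    ∀ x y : M2, x ≠ y →
      |(f x - f' x) - (f y - f' y)| ≤ (1 + 20 * α) * d2 x y := by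
  obtain ⟨ha1, ha2, hfc, hfe, hfo⟩ := bounds_of_nearly_extremal hLip hc ha hb
  obtain ⟨ha1', ha2', hfc', hfe', hfo'⟩ := bounds_of_nearly_extremal hLip' hc' ha' hb'
  have hgb : ∀ m, |f (pb m) - f' (pb m)| ≤ 1 + 8 * α := fun m => by
    rw [abs_le]
    rcases m.even_or_odd with hm | hm
    · have := hfe m hm
      have := hfe' m hm
      constructor <;> linarith
    · have := hfo m hm
      have := hfo' m hm
      constructor <;> linarith
  have hg : ∀ x, (∃ m, x = pb m) ∨ |f x - f' x| ≤ 12 * α := fun x => by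
    rcases M2_cases x with rfl | rfl | hx | ⟨m, rfl⟩
    · exact Or.inr (abs_le.2 ⟨by linarith, by linarith⟩)
    · exact Or.inr (abs_le.2 ⟨by linarith, by linarith⟩)
    · exact Or.inl hx
    · have h := abs_le.1 (hfc m)
      have h' := abs_le.1 (hfc' m)
      exact Or.inr (abs_le.2 ⟨by linarith, by linarith⟩)
  intro x y hxy
  have htri := abs_sub (f x - f' x) (f y - f' y)
  have hd : 1 + 20 * α ≤ (1 + 20 * α) * d2 x y :=
    le_mul_of_one_le_right (by linarith) (one_le_d2 hxy)
  rcases hg x with ⟨m, rfl⟩ | hx <;> rcases hg y with ⟨n, rfl⟩ | hy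
  · rw [d2_pb_pb hxy]
    linarith [hgb m, hgb n]
  · linarith [hgb m]
  · linarith [hgb n]
  · linarith
end

section
/- Let M = {e_i + e_j : i, j ∈ ℕ} regarded as a metric subspace of ℓ¹, and let 0 < ε < 1/3. Then there do not exist pairwise disjoint subsets A₁, …, A₆ of M together with points u_m, v_m ∈ A_m, u_m ≠ v_m (m = 1,…,6), such that (1−ε)(‖x − y‖₁ + ‖u_m − v_m‖₁) ≤ ‖x − u_m‖₁ + ‖y − v_m‖₁ for all m ∈ {1,…,6} and all x, y ∈ M∖A_m. In particular, M does not have the seq-LTP. -/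
/-- The `i`-th standard unit vector of `ℓ¹ = lp (fun _ : ℕ => ℝ) 1`. -/
noncomputable def ee (i : ℕ) : lp (fun _ : ℕ => ℝ) 1 := lp.single 1 i 1

/-- The subset `M = {e_i + e_j : i, j ∈ ℕ}` of `ℓ¹`. -/
def Mset : Set (lp (fun _ : ℕ => ℝ) 1) := {x | ∃ i j : ℕ, x = ee i + ee j}

/-- The metric space `M` has the seq-LTP. -/
def SeqLTP (M : Type*) [MetricSpace M] : Prop :=
  ∀ ε : ℝ, 0 < ε →
    ∃ (A : ℕ → Set M) (u v : ℕ → M),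
      (∀ m m' : ℕ, m ≠ m' → Disjoint (A m) (A m')) ∧
      ∀ m : ℕ, u m ∈ A m ∧ v m ∈ A m ∧ u m ≠ v m ∧
        ∀ x ∉ A m, ∀ y ∉ A m,
          (1 - ε) * (dist x y + dist (u m) (v m)) ≤ dist x (u m) + dist y (v m)

lemma ee_apply (i k : ℕ) : (ee i : ℕ → ℝ) k = if k = i then 1 else 0 := by
  simp [ee, Pi.single_apply]

lemma norm_ee (i : ℕ) : ‖ee i‖ = 1 := by
  simp [ee, lp.norm_single]

lemma sum_abs_le_norm (f : lp (fun _ : ℕ => ℝ) 1) (s : Finset ℕ) :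
    ∑ k ∈ s, |f k| ≤ ‖f‖ := by
  simpa using lp.sum_rpow_le_norm_rpow (p := 1) (by simp) f s

lemma norm_ee_add_sub_le (i n j : ℕ) : ‖(ee i + ee n) - (ee i + ee j)‖ ≤ 2 := by
  rw [add_sub_add_left_eq_sub]
  have h := norm_sub_le (ee n) (ee j)
  rw [norm_ee, norm_ee] at h
  linarith

lemma two_le_norm_ee_sub {a b : ℕ} (h : a ≠ b) : 2 ≤ ‖ee a - ee b‖ := by
  have hs := sum_abs_le_norm (ee a - ee b) {a, b}
  rw [Finset.sum_pair h] at hs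
  simp [ee_apply, h, h.symm] at hs
  linarith

lemma four_le_norm_of_disjoint {a b c d : ℕ} (hac : a ≠ c) (had : a ≠ d) (hbc : b ≠ c)
    (hbd : b ≠ d) : 4 ≤ ‖(ee a + ee b) - (ee c + ee d)‖ := by
  have hs := sum_abs_le_norm ((ee a + ee b) - (ee c + ee d)) ({a, b} ∪ {c, d})
  rw [Finset.sum_union (by
    simp only [Finset.disjoint_insert_left, Finset.disjoint_singleton_left, Finset.mem_insert,
      Finset.mem_singleton]
    tauto)] at hs
  by_cases hab : a = b <;> by_cases hcd : c = d
  · subst hab hcd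
    simp [ee_apply, hac, hac.symm] at hs
    norm_num [abs_of_nonpos] at hs
    linarith
  · subst hab
    rw [Finset.sum_pair hcd] at hs
    simp [ee_apply, hac, hac.symm, had, had.symm, hcd, Ne.symm hcd] at hs
    norm_num at hs
    linarith
  · subst hcd
    rw [Finset.sum_pair hab] at hs
    simp [ee_apply, hac, hac.symm, hbc, hbc.symm, hab, Ne.symm hab] at hs
    norm_num [abs_of_nonpos] at hs
    linarith
  · rw [Finset.sum_pair hab, Finset.sum_pair hcd] at hs
    simp [ee_apply, hac, hac.symm, hbc, hbc.symm, had, had.symm, hbd, hbd.symm, hab,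
      Ne.symm hab, hcd, Ne.symm hcd] at hs
    linarith

lemma two_le_norm_of_ne {x y : lp (fun _ : ℕ => ℝ) 1} (hx : x ∈ Mset) (hy : y ∈ Mset)
    (h : x ≠ y) : 2 ≤ ‖x - y‖ := by
  obtain ⟨a, b, rfl⟩ := hx
  obtain ⟨c, d, rfl⟩ := hy
  by_cases hac : a = c
  · subst hac
    rw [add_sub_add_left_eq_sub]
    exact two_le_norm_ee_sub (by rintro rfl; exact h rfl)
  by_cases had : a = d
  · subst had
    rw [add_comm (ee c), add_sub_add_left_eq_sub]
    exact two_le_norm_ee_sub (by rintro rfl; exact h (add_comm _ _))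
  by_cases hbc : b = c
  · subst hbc
    rw [add_comm (ee a), add_sub_add_left_eq_sub]
    exact two_le_norm_ee_sub had
  by_cases hbd : b = d
  · subst hbd
    rw [add_sub_add_right_eq_sub]
    exact two_le_norm_ee_sub hac
  linarith [four_le_norm_of_disjoint hac had hbc hbd]

/-- The set `A` contains every point `e_i + e_n` of the star centred at `i`, except possibly the
one with `n = p`. -/
def ContainsStar (A : Set (lp (fun _ : ℕ => ℝ) 1)) (i p : ℕ) : Prop :=
  ∀ n, n ≠ p → ee i + ee n ∈ A

/-- If `A` contains no star up to one point, then every star has a point outside `A` whose second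
index differs from `p`. -/
lemma exists_notMem_of_not_containsStar {A : Set (lp (fun _ : ℕ => ℝ) 1)}
    (h : ¬ ∃ i p, ContainsStar A i p) (i p : ℕ) : ∃ n, n ≠ p ∧ ee i + ee n ∉ A := by
  by_contra! hc
  exact h ⟨i, p, hc⟩

/-- The long trapezoid inequality for `u, v` with parameter `ε` holds for all points of `M`
outside `A`. -/
def LongTrapezoid (ε : ℝ) (A : Set (lp (fun _ : ℕ => ℝ) 1)) (u v : lp (fun _ : ℕ => ℝ) 1) :
    Prop :=
  ∀ x ∈ Mset, x ∉ A → ∀ y ∈ Mset, y ∉ A →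
    (1 - ε) * (‖x - y‖ + ‖u - v‖) ≤ ‖x - u‖ + ‖y - v‖

lemma LongTrapezoid.symm {ε : ℝ} {A : Set (lp (fun _ : ℕ => ℝ) 1)}
    {u v : lp (fun _ : ℕ => ℝ) 1} (h : LongTrapezoid ε A u v) : LongTrapezoid ε A v u := by
  intro x hx hxA y hy hyA
  have := h y hy hyA x hx hxA
  rw [norm_sub_rev y x, norm_sub_rev u v] at this
  linarith

lemma LongTrapezoid.false_of_le {ε : ℝ} (hε : ε < 1 / 3) {A : Set (lp (fun _ : ℕ => ℝ) 1)}
    {u v x y : lp (fun _ : ℕ => ℝ) 1} (h : LongTrapezoid ε A u v) (hx : x ∈ Mset) (hxA : x ∉ A)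
    (hy : y ∈ Mset) (hyA : y ∉ A) (hxu : ‖x - u‖ ≤ 2) (hyv : ‖y - v‖ ≤ 2)
    (hsum : 6 ≤ ‖x - y‖ + ‖u - v‖) : False := by
  have := h x hx hxA y hy hyA
  nlinarith

/-- The case of `u, v` at distance `4`. -/
lemma LongTrapezoid.exists_star_of_disjoint {ε : ℝ} (hε : ε < 1 / 3)
    {A : Set (lp (fun _ : ℕ => ℝ) 1)} {i j k l : ℕ}
    (h : LongTrapezoid ε A (ee i + ee j) (ee k + ee l))
    (hd : 4 ≤ ‖(ee i + ee j) - (ee k + ee l)‖) : ∃ i p, ContainsStar A i p := by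
  by_contra hA
  obtain ⟨n₁, -, h₁⟩ := exists_notMem_of_not_containsStar hA i 0
  obtain ⟨n₂, hn, h₂⟩ := exists_notMem_of_not_containsStar hA i n₁
  obtain ⟨m, -, hm⟩ := exists_notMem_of_not_containsStar hA k 0
  have key : ∀ n, ee i + ee n ∉ A → ee i + ee n = ee k + ee m := by
    intro n hnA
    by_contra hne
    exact h.false_of_le hε ⟨i, n, rfl⟩ hnA ⟨k, m, rfl⟩ hm (norm_ee_add_sub_le i n j)
      (norm_ee_add_sub_le k m l)
      (by linarith [two_le_norm_of_ne ⟨i, n, rfl⟩ ⟨k, m, rfl⟩ hne])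
  have heq : ee n₂ = ee n₁ := add_left_cancel ((key n₂ h₂).trans (key n₁ h₁).symm)
  have := two_le_norm_ee_sub hn
  rw [heq, sub_self, norm_zero] at this
  linarith

/-- The case of `u, v` sharing an index `i`, with the other index of `u` different from `i`. -/
lemma LongTrapezoid.exists_star_of_common_of_ne {ε : ℝ} (hε : ε < 1 / 3)
    {A : Set (lp (fun _ : ℕ => ℝ) 1)} {i j k : ℕ} (hu : ee i + ee j ∈ A)
    (h : LongTrapezoid ε A (ee i + ee j) (ee i + ee k)) (hjk : j ≠ k) (hji : j ≠ i) :
    ∃ i p, ContainsStar A i p := by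
  by_contra hA
  obtain ⟨l, hli, hl⟩ := exists_notMem_of_not_containsStar hA j i
  obtain ⟨n, hnl, hn⟩ := exists_notMem_of_not_containsStar hA i l
  have hnj : n ≠ j := by rintro rfl; exact hn hu
  refine h.false_of_le hε ⟨j, l, rfl⟩ hl ⟨i, n, rfl⟩ hn ?_ (norm_ee_add_sub_le i n k) ?_
  · rw [add_comm (ee i)]
    exact norm_ee_add_sub_le j l i
  · have h₁ := four_le_norm_of_disjoint hji hnj.symm hli hnl.symm
    have h₂ := two_le_norm_ee_sub hjk
    rw [add_sub_add_left_eq_sub]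
    linarith

lemma LongTrapezoid.exists_star_of_common {ε : ℝ} (hε : ε < 1 / 3)
    {A : Set (lp (fun _ : ℕ => ℝ) 1)} {i j k : ℕ} (hu : ee i + ee j ∈ A) (hv : ee i + ee k ∈ A)
    (h : LongTrapezoid ε A (ee i + ee j) (ee i + ee k)) (hne : ee i + ee j ≠ ee i + ee k) :
    ∃ i p, ContainsStar A i p := by
  have hjk : j ≠ k := by rintro rfl; exact hne rfl
  by_cases hji : j = i
  · exact h.symm.exists_star_of_common_of_ne hε hv hjk.symm (by rw [← hji]; exact hjk.symm)
  · exact h.exists_star_of_common_of_ne hε hu hjk hji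

lemma LongTrapezoid.exists_star {ε : ℝ} (hε : ε < 1 / 3) {A : Set (lp (fun _ : ℕ => ℝ) 1)}
    {u v : lp (fun _ : ℕ => ℝ) 1} (hA : A ⊆ Mset) (hu : u ∈ A) (hv : v ∈ A) (hne : u ≠ v)
    (h : LongTrapezoid ε A u v) : ∃ i p, ContainsStar A i p := by
  obtain ⟨i, j, rfl⟩ := hA hu
  obtain ⟨k, l, rfl⟩ := hA hv
  by_cases hik : i = k
  · subst hik
    exact h.exists_star_of_common hε hu hv hne
  by_cases hil : i = l
  · subst hil
    rw [add_comm (ee k)] at hv hne h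
    exact h.exists_star_of_common hε hu hv hne
  by_cases hjk : j = k
  · subst hjk
    rw [add_comm (ee i)] at hu hne h
    exact h.exists_star_of_common hε hu hv hne
  by_cases hjl : j = l
  · subst hjl
    rw [add_comm (ee i)] at hu hne h
    rw [add_comm (ee k)] at hv hne h
    exact h.exists_star_of_common hε hu hv hne
  exact h.exists_star_of_disjoint hε (four_le_norm_of_disjoint hik hil hjk hjl)

/-- Disjoint sets containing stars up to one point have different centres, and one of them misses
the point joining the two centres. -/
lemma ContainsStar.of_disjoint {A B : Set (lp (fun _ : ℕ => ℝ) 1)} {i p j q : ℕ}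
    (hA : ContainsStar A i p) (hB : ContainsStar B j q) (hAB : Disjoint A B) :
    i ≠ j ∧ (p = j ∨ q = i) := by
  constructor
  · rintro rfl
    exact Set.disjoint_left.1 hAB (hA (p + q + 1) (by omega)) (hB (p + q + 1) (by omega))
  · by_contra! hc
    have hj := hB i hc.2.symm
    rw [add_comm] at hj
    exact Set.disjoint_left.1 hAB (hA j hc.1.symm) hj

lemma not_exists_longTrapezoid_family {ε : ℝ} (hε : ε < 1 / 3) :
    ¬ ∃ (A : Fin 6 → Set (lp (fun _ : ℕ => ℝ) 1)) (u v : Fin 6 → lp (fun _ : ℕ => ℝ) 1),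
      (∀ m, A m ⊆ Mset) ∧ (∀ m m' : Fin 6, m ≠ m' → Disjoint (A m) (A m')) ∧
      (∀ m, u m ∈ A m ∧ v m ∈ A m ∧ u m ≠ v m) ∧ (∀ m, LongTrapezoid ε (A m) (u m) (v m)) := by
  rintro ⟨A, u, v, hA, hdisj, huv, h⟩
  choose i p hs using fun m =>
    (h m).exists_star hε (hA m) (huv m).1 (huv m).2.1 (huv m).2.2
  have key := fun m m' hm => (hs m).of_disjoint (hs m') (hdisj m m' hm)
  have h01 := key 0 1 (by decide)
  have h02 := key 0 2 (by decide)
  have h03 := key 0 3 (by decide)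
  have h12 := key 1 2 (by decide)
  have h13 := key 1 3 (by decide)
  have h23 := key 2 3 (by decide)
  omega

theorem stmt_16 (ε : ℝ) (hε0 : 0 < ε) (hε1 : ε < 1 / 3) :
    (¬ ∃ (A : Fin 6 → Set (lp (fun _ : ℕ => ℝ) 1))
        (u v : Fin 6 → lp (fun _ : ℕ => ℝ) 1),
      (∀ m, A m ⊆ Mset) ∧
      (∀ m m' : Fin 6, m ≠ m' → Disjoint (A m) (A m')) ∧
      (∀ m, u m ∈ A m ∧ v m ∈ A m ∧ u m ≠ v m) ∧
      (∀ m, ∀ x ∈ Mset, x ∉ A m → ∀ y ∈ Mset, y ∉ A m →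
        (1 - ε) * (‖x - y‖ + ‖u m - v m‖) ≤ ‖x - u m‖ + ‖y - v m‖)) ∧
    ¬ SeqLTP ↥Mset := by
  refine ⟨not_exists_longTrapezoid_family hε1, fun hM => ?_⟩
  obtain ⟨A, u, v, hdisj, h⟩ := hM ε hε0
  refine not_exists_longTrapezoid_family hε1
    ⟨fun m => Set.image Subtype.val (A m), fun m => u m, fun m => v m, fun m => ?_, fun m m' hm => ?_,
      fun m => ?_, fun m x hx hxA y hy hyA => ?_⟩
  · rintro _ ⟨x, -, rfl⟩
    exact x.2
  · exact (Set.disjoint_image_iff Subtype.val_injective).2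
      (hdisj m m' (fun hc => hm (Fin.ext hc)))
  · obtain ⟨hu, hv, hne, -⟩ := h m
    exact ⟨⟨_, hu, rfl⟩, ⟨_, hv, rfl⟩, fun hc => hne (Subtype.ext hc)⟩
  · have := (h m).2.2.2 ⟨x, hx⟩ (fun hc => hxA ⟨_, hc, rfl⟩) ⟨y, hy⟩ (fun hc => hyA ⟨_, hc, rfl⟩)
    simpa only [Subtype.dist_eq, dist_eq_norm] using this
end
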